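/- Let N ≥ 3, let B be the open unit ball in ℝ^N, let β ≥ 0 and λ ≤ 0. Then there is no radial function u, continuously differentiable on the closed unit ball and twice continuously differentiable on B, with u > 0 in B and u = 0 on the unit sphere, satisfying −Δu(x) = (1 + λ·|x|^β)·u(x)^((N+2)/(N−2)) for all x ∈ B. -/

import Mathlib

open scoped NNReal
open MeasureTheory Filter Set Metric

noncomputable def laplacian {N : ℕ} (u : EuclideanSpace ℝ (Fin N) → ℝ)
    (x : EuclideanSpace ℝ (Fin N)) : ℝ :=
  ∑ i, fderiv ℝ (fun y => fderiv ℝ u y (EuclideanSpace.single i (1:ℝ))) x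
      (EuclideanSpace.single i (1:ℝ))

lemma aux_ode (m : ℕ) (β lam p : ℝ) (hβ : 0 ≤ β) (hlam : lam ≤ 0)
    (hp : p = ((m : ℝ) + 5) / ((m : ℝ) + 1)) (v d : ℝ → ℝ)
    (hvc : ContinuousOn v (Icc 0 1)) (hdc : ContinuousOn d (Icc 0 1))
    (hv : ∀ r ∈ Ioo (0:ℝ) 1, HasDerivAt v (d r) r)
    (hd : ∀ r ∈ Ioo (0:ℝ) 1,
      HasDerivAt d (-(((m : ℝ) + 2) / r * d r) - (1 + lam * r ^ β) * v r ^ p) r)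
    (hpos : ∀ r ∈ Ico (0:ℝ) 1, 0 < v r) (hv1 : v 1 = 0) : False := by
  have hm : (0:ℝ) < (m:ℝ) + 1 := by positivity
  have hp0 : 0 < p + 1 := by rw [hp]; positivity
  let P : ℝ → ℝ := fun r => r ^ (m+3) * (d r ^ 2 / 2 + (1 + lam * r ^ β) * v r ^ (p+1) / (p+1))
    + ((m:ℝ)+1)/2 * r ^ (m+2) * (v r * d r)
  have hrb : Continuous (fun r : ℝ => r ^ β) := Real.continuous_rpow_const hβ
  have hvq : ContinuousOn (fun r => v r ^ (p+1)) (Icc 0 1) :=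
    (Real.continuous_rpow_const hp0.le).comp_continuousOn hvc
  have hPc : ContinuousOn P (Icc 0 1) := by
    have h1 : ContinuousOn (fun r : ℝ => 1 + lam * r ^ β) (Icc 0 1) :=
      (continuous_const.add (continuous_const.mul hrb)).continuousOn
    have h2 : ContinuousOn (fun r : ℝ => r ^ (m+3)) (Icc 0 1) := (continuous_pow _).continuousOn
    have h3 : ContinuousOn (fun r : ℝ => ((m:ℝ)+1)/2 * r ^ (m+2)) (Icc 0 1) :=
      (continuous_const.mul (continuous_pow _)).continuousOn
    exact (h2.mul (((hdc.pow 2).div_const 2).add ((h1.mul hvq).div_const _))).add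
      (h3.mul (hvc.mul hdc))
  have hPd : ∀ r ∈ Ioo (0:ℝ) 1, HasDerivAt P
      (r ^ (m+3) * (lam * (β * r ^ (β-1))) * (v r ^ (p+1)) / (p+1)) r := by
    intro r hr
    have hvp := hpos r ⟨hr.1.le, hr.2⟩
    have hr0 : r ≠ 0 := hr.1.ne'
    have e1 := hv r hr
    have e2 := hd r hr
    have e3 : HasDerivAt (fun r : ℝ => 1 + lam * r ^ β) (lam * (β * r ^ (β-1))) r :=
      ((Real.hasDerivAt_rpow_const (Or.inl hr0)).const_mul lam).const_add 1
    have e4 := e1.rpow_const (p := p+1) (Or.inl hvp.ne')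
    have e5 := hasDerivAt_pow (m+3) r
    have e6 := (hasDerivAt_pow (m+2) r).const_mul (((m:ℝ)+1)/2)
    have e7 := (e5.mul (((e2.pow 2).div_const 2).add ((e3.mul e4).div_const (p+1)))).add
      (e6.mul (e1.mul e2))
    refine e7.congr_deriv ?_
    simp only [Pi.mul_apply, Pi.add_apply, Pi.pow_apply]
    have e8 : v r ^ (p+1) = v r ^ p * v r := by
      rw [Real.rpow_add hvp, Real.rpow_one]
    have e9 : p + 1 - 1 = p := by ring
    rw [e9, e8]
    have hpe : p + 1 = 2 * ((m:ℝ)+3) / ((m:ℝ)+1) := by rw [hp]; field_simp; ring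
    rw [hpe]
    generalize v r ^ p = A
    generalize r ^ (β-1) = B
    generalize r ^ β = C
    generalize v r = V
    generalize d r = D
    have hm3 : (m:ℝ) + 3 ≠ 0 := by positivity
    have : m + 3 - 1 = m + 2 := rfl
    have : m + 2 - 1 = m + 1 := rfl
    simp only [*]
    push_cast
    field_simp
    ring
  have hP0 : P 0 = 0 := by simp [P]
  have hP1 : P 1 = d 1 ^ 2 / 2 := by
    simp [P, hv1, Real.zero_rpow hp0.ne']
  obtain ⟨r, hr, hPr⟩ := exists_hasDerivAt_eq_slope P _ one_pos hPc hPd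
  rw [hP0, hP1] at hPr
  have hrpos := hr.1
  have hvp := hpos r ⟨hr.1.le, hr.2⟩
  by_cases hc : lam * β = 0
  · have hd1 : d 1 = 0 := by
      have : r ^ (m+3) * (lam * (β * r ^ (β-1))) * (v r ^ (p+1)) / (p+1) = 0 := by
        rw [← mul_assoc lam, hc]; simp
      rw [this] at hPr
      have : d 1 ^ 2 = 0 := by linarith
      simpa using this
    obtain ⟨c, hcK⟩ : ∃ c : ℝ, ∀ s : ℝ, 1 + lam * s ^ β = c := by
      rcases mul_eq_zero.mp hc with h | h
      · exact ⟨1, fun s => by rw [h]; simp⟩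
      · exact ⟨1 + lam, fun s => by rw [h]; simp⟩
    simp only [hcK] at hd
    let w : ℝ → ℝ := fun s => s ^ (m+2) * d s
    have hwc : ContinuousOn w (Icc 0 1) := (continuous_pow _).continuousOn.mul hdc
    have hwd : ∀ s ∈ Ioo (0:ℝ) 1, HasDerivAt w (-(c * (s ^ (m+2) * v s ^ p))) s := by
      intro s hs
      refine ((hasDerivAt_pow (m+2) s).mul (hd s hs)).congr_deriv ?_
      have hs0 : s ≠ 0 := hs.1.ne'
      have : m + 2 - 1 = m + 1 := rfl
      rw [this]
      push_cast
      field_simp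
      ring
    have hw0 : w 0 = 0 := by simp [w]
    have hw1 : w 1 = 0 := by simp [w, hd1]
    obtain ⟨s, hs, hws⟩ := exists_hasDerivAt_eq_slope w _ one_pos hwc hwd
    rw [hw0, hw1] at hws
    have hsv : 0 < s ^ (m+2) * v s ^ p :=
      mul_pos (pow_pos hs.1 _) (Real.rpow_pos_of_pos (hpos s ⟨hs.1.le, hs.2⟩) _)
    have hc0 : c = 0 := by
      have : c * (s ^ (m+2) * v s ^ p) = 0 := by linarith
      rcases mul_eq_zero.mp this with h | h
      · exact h
      · exact absurd h hsv.ne'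
    obtain ⟨t, ht, hvt⟩ := exists_hasDerivAt_eq_slope v d one_pos hvc hv
    obtain ⟨z, hz, hwz⟩ := exists_hasDerivAt_eq_slope w _ ht.1
      (hwc.mono (Icc_subset_Icc_right ht.2.le)) (fun z hz => hwd z ⟨hz.1, hz.2.trans ht.2⟩)
    rw [hc0, hw0] at hwz
    have hwt : w t = 0 := by
      have h := ht.1.ne'
      field_simp at hwz
      linarith
    have hdt : d t = 0 := by
      rcases mul_eq_zero.mp hwt with h | h
      · exact absurd h (pow_pos ht.1 _).ne'
      · exact h
    have := hpos 0 ⟨le_rfl, one_pos⟩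
    rw [hdt, hv1] at hvt
    linarith
  · have hneg : lam * β < 0 := lt_of_le_of_ne (mul_nonpos_of_nonpos_of_nonneg hlam hβ) hc
    have h1 : r ^ (m+3) * (lam * (β * r ^ (β-1))) * (v r ^ (p+1)) / (p+1)
        = (lam * β) * (r ^ (m+3) * r ^ (β-1) * (v r ^ (p+1)) / (p+1)) := by ring
    have h2 : 0 < r ^ (m+3) * r ^ (β-1) * (v r ^ (p+1)) / (p+1) := by positivity
    have h3 := mul_neg_of_neg_of_pos hneg h2
    rw [h1] at hPr
    have := sq_nonneg (d 1)
    linarith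

lemma aux_second {N : ℕ} (u : EuclideanSpace ℝ (Fin N) → ℝ) (x e : EuclideanSpace ℝ (Fin N))
    (hu : ContDiffAt ℝ 2 u x) (g : ℝ → ℝ) (c : ℝ)
    (hg : ∀ᶠ t in nhds (0:ℝ), HasDerivAt (fun t => u (x + t • e)) (g t) t)
    (hg2 : HasDerivAt g c 0) :
    fderiv ℝ (fun y => fderiv ℝ u y e) x e = c := by
  have hline : ∀ t : ℝ, HasDerivAt (fun t : ℝ => x + t • e) e t := fun t => by
    simpa using ((hasDerivAt_id t).smul_const e).const_add x
  have hcont : ContinuousAt (fun t : ℝ => x + t • e) 0 := (hline 0).continuousAt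
  have hx0 : x + (0:ℝ) • e = x := by simp
  have hev : ∀ᶠ y in nhds x, DifferentiableAt ℝ u y :=
    (hu.eventually (by simp)).mono fun y hy => hy.differentiableAt (by simp)
  have hev' : ∀ᶠ t in nhds (0:ℝ), DifferentiableAt ℝ u (x + t • e) := by
    apply hcont.eventually
    simpa only [hx0] using hev
  have heq : (fun t : ℝ => fderiv ℝ u (x + t • e) e) =ᶠ[nhds 0] g := by
    filter_upwards [hg, hev'] with t h1 h2
    exact (h2.hasFDerivAt.comp_hasDerivAt t (hline t)).unique h1
  have hdf : DifferentiableAt ℝ (fun y => fderiv ℝ u y e) x := by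
    have : ContDiffAt ℝ 1 (fderiv ℝ u) x := hu.fderiv_right (by norm_num)
    exact (this.differentiableAt (by simp)).clm_apply (differentiableAt_const _)
  have h3 : HasDerivAt (fun t : ℝ => fderiv ℝ u (x + t • e) e)
      (fderiv ℝ (fun y => fderiv ℝ u y e) x e) 0 := by
    have h4 : HasFDerivAt (fun y => fderiv ℝ u y e) (fderiv ℝ (fun y => fderiv ℝ u y e) x)
      (x + (0:ℝ) • e) := by rw [hx0]; exact hdf.hasFDerivAt
    exact h4.comp_hasDerivAt (0:ℝ) (hline 0)
  exact h3.unique (hg2.congr_of_eventuallyEq heq)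

lemma aux_lap (m : ℕ) (u : EuclideanSpace ℝ (Fin (m+3)) → ℝ)
    (hrad : ∀ x y : EuclideanSpace ℝ (Fin (m+3)), ‖x‖ = ‖y‖ → u x = u y)
    (v : ℝ → ℝ) (hv : v = fun r => u (r • EuclideanSpace.single 0 (1:ℝ)))
    (d : ℝ → ℝ) (hd : ∀ r ∈ Ioo (0:ℝ) 1, HasDerivAt v (d r) r) (r c : ℝ) (hr : r ∈ Ioo (0:ℝ) 1)
    (hdd : HasDerivAt d c r)
    (hu : ContDiffAt ℝ 2 u (r • EuclideanSpace.single 0 (1:ℝ))) :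
    laplacian u (r • EuclideanSpace.single 0 (1:ℝ)) = c + ((m:ℝ)+2) / r * d r := by
  unfold laplacian
  rw [Fin.sum_univ_succ]
  have hnhd : Ioo (0:ℝ) 1 ∈ nhds r := Ioo_mem_nhds hr.1 hr.2
  congr 1
  · apply aux_second u _ _ hu (fun t => d (r + t))
    · have : ContinuousAt (fun t : ℝ => r + t) 0 := by fun_prop
      have h2 := this.preimage_mem_nhds (t := Ioo (0:ℝ) 1) (by simpa using hnhd)
      filter_upwards [h2] with t ht
      have h3 := (hd (r+t) ht).comp_const_add r t
      rw [hv] at h3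
      simpa only [add_smul] using h3
    · have : HasDerivAt d c (r + 0) := by simpa using hdd
      exact this.comp_const_add r 0
  · have key : ∀ i : Fin (m+2), fderiv ℝ (fun y => fderiv ℝ u y
        (EuclideanSpace.single i.succ (1:ℝ))) (r • EuclideanSpace.single 0 (1:ℝ))
        (EuclideanSpace.single i.succ (1:ℝ)) = d r / r := by
      intro i
      let s : ℝ → ℝ := fun t => √(r^2 + t^2)
      have hs0 : s 0 = r := by simp [s, hr.1.le]
      have hsd : ∀ t, HasDerivAt s (t / s t) t := by
        intro t
        have hpos : r^2 + t^2 ≠ 0 := by have := hr.1; positivity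
        have h1 : HasDerivAt (fun t : ℝ => r^2 + t^2) (2 * t) t := by
          simpa using (hasDerivAt_pow 2 t).const_add (r^2)
        refine (h1.sqrt hpos).congr_deriv ?_
        simp only [s]
        rw [mul_div_mul_left _ _ two_ne_zero]
      have hus : ∀ t, u (r • EuclideanSpace.single 0 (1:ℝ) +
          t • EuclideanSpace.single i.succ (1:ℝ)) = v (s t) := by
        intro t
        rw [hv]
        apply hrad
        rw [norm_smul, EuclideanSpace.norm_single, EuclideanSpace.norm_eq]
        have h0 : 0 ≤ s t := Real.sqrt_nonneg _
        rw [norm_one, mul_one, Real.norm_of_nonneg h0]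
        simp only [s]
        congr 1
        rw [Fin.sum_univ_succ, Finset.sum_eq_single i]
        · simp
        · intro j _ hj
          simp [hj]
        · simp
      apply aux_second u _ _ hu (fun t => d (s t) * (t / s t))
      · have h2 := (hsd 0).continuousAt.preimage_mem_nhds (t := Ioo (0:ℝ) 1)
          (by rw [hs0]; exact hnhd)
        filter_upwards [h2] with t ht
        simp only [hus]
        exact (hd (s t) ht).comp t (hsd t)
      · have hdd' : HasDerivAt d c (s 0) := by rw [hs0]; exact hdd
        have h1 := hdd'.comp 0 (hsd 0)
        have h2 := (hasDerivAt_id (0:ℝ)).div (hsd 0) (by rw [hs0]; exact hr.1.ne')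
        refine (h1.mul h2).congr_deriv ?_
        have := hr.1.ne'
        simp [hs0]
        field_simp
    rw [Finset.sum_congr rfl (fun i _ => key i)]
    simp
    ring

theorem stmt_7 (N : ℕ) (hN : 3 ≤ N) (β lam : ℝ) (hβ : 0 ≤ β) (hlam : lam ≤ 0) :
    ¬ ∃ u : EuclideanSpace ℝ (Fin N) → ℝ,
      (∀ x y : EuclideanSpace ℝ (Fin N), ‖x‖ = ‖y‖ → u x = u y) ∧
      ContDiffOn ℝ 1 u (closedBall 0 1) ∧
      ContDiffOn ℝ 2 u (ball 0 1) ∧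
      (∀ x ∈ ball (0 : EuclideanSpace ℝ (Fin N)) 1, 0 < u x) ∧
      (∀ x ∈ sphere (0 : EuclideanSpace ℝ (Fin N)) 1, u x = 0) ∧
      (∀ x ∈ ball (0 : EuclideanSpace ℝ (Fin N)) 1,
        -laplacian u x = (1 + lam * ‖x‖ ^ β) * u x ^ (((N : ℝ) + 2) / ((N : ℝ) - 2))) := by
  rintro ⟨u, hrad, hC1, hC2, hpos, hzero, heq⟩
  obtain ⟨m, rfl⟩ : ∃ m, N = m + 3 := ⟨N - 3, by omega⟩
  set e : EuclideanSpace ℝ (Fin (m+3)) := EuclideanSpace.single 0 (1:ℝ) with he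
  have hen : ‖e‖ = 1 := by simp [he]
  have hnorm : ∀ r : ℝ, 0 ≤ r → ‖r • e‖ = r := fun r hr => by
    rw [norm_smul, hen, mul_one, Real.norm_of_nonneg hr]
  obtain ⟨v, hv⟩ : ∃ v : ℝ → ℝ, v = fun r => u (r • e) := ⟨_, rfl⟩
  have hlin : ContDiff ℝ 2 (fun r : ℝ => r • e) := by fun_prop
  have hvC1 : ContDiffOn ℝ 1 v (Icc 0 1) := by
    rw [hv]
    refine hC1.comp (hlin.of_le (by norm_num)).contDiffOn ?_
    intro r hr
    simpa [hnorm r hr.1] using hr.2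
  have hball : ∀ r ∈ Ico (0:ℝ) 1, r • e ∈ ball (0 : EuclideanSpace ℝ (Fin (m+3))) 1 := by
    intro r hr
    simpa [hnorm r hr.1] using hr.2
  have hvC2 : ContDiffOn ℝ 2 v (Ioo 0 1) := by
    rw [hv]
    exact hC2.comp hlin.contDiffOn (fun r hr => hball r ⟨hr.1.le, hr.2⟩)
  have hUD : UniqueDiffOn ℝ (Icc (0:ℝ) 1) := uniqueDiffOn_Icc one_pos
  obtain ⟨d, hd⟩ : ∃ d, d = derivWithin v (Icc 0 1) := ⟨_, rfl⟩
  have hdc : ContinuousOn d (Icc 0 1) := by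
    rw [hd]; exact hvC1.continuousOn_derivWithin hUD (by norm_num)
  have hdeq : ∀ r ∈ Ioo (0:ℝ) 1, d r = deriv v r := fun r hr => by
    rw [hd]; exact derivWithin_of_mem_nhds (Icc_mem_nhds hr.1 hr.2)
  have hvd : ∀ r ∈ Ioo (0:ℝ) 1, HasDerivAt v (d r) r := fun r hr => by
    rw [hdeq r hr]
    exact ((hvC2.contDiffAt (Ioo_mem_nhds hr.1 hr.2)).differentiableAt (by norm_num)).hasDerivAt
  have hdd : ∀ r ∈ Ioo (0:ℝ) 1, DifferentiableAt ℝ d r := fun r hr => by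
    have hnh := Ioo_mem_nhds hr.1 hr.2
    have h1 : ContDiffOn ℝ 1 (deriv v) (Ioo 0 1) :=
      hvC2.deriv_of_isOpen isOpen_Ioo (by norm_num)
    have h2 := (h1.contDiffAt hnh).differentiableAt (by norm_num)
    refine h2.congr_of_eventuallyEq ?_
    filter_upwards [hnh] with s hs using hdeq s hs
  refine aux_ode m β lam ((((m+3 : ℕ) : ℝ) + 2) / (((m+3 : ℕ) : ℝ) - 2)) hβ hlam ?_ v d
    hvC1.continuousOn hdc hvd ?_ ?_ ?_
  · push_cast; congr 1 <;> ring
  · intro r hr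
    refine (hdd r hr).hasDerivAt.congr_deriv ?_
    have hb := hball r ⟨hr.1.le, hr.2⟩
    have h1 := aux_lap m u hrad v hv d hvd r _ hr (hdd r hr).hasDerivAt
      (hC2.contDiffAt (isOpen_ball.mem_nhds hb))
    have h2 := heq _ hb
    rw [h1, hnorm r hr.1.le] at h2
    have h3 : v r = u (r • e) := by rw [hv]
    rw [h3]
    linarith
  · intro r hr
    rw [hv]
    exact hpos _ (hball r hr)
  · rw [hv]
    exact hzero _ (by simp [hen])
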